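/- For all integers n ≥ 1 and m ≥ 0, the number of basketball walks of length n from 0 to 1 that are positive except at the origin and that contain exactly m staggered ±2-steps is equal to the number of increasing unary-binary trees with n vertices whose associated permutation avoids 213 and that have exactly m unary nodes. -/

import Mathlib

/-- Height of a walk (given by its list of steps) after `i` steps. -/
def ht (s : List ℤ) (i : ℕ) : ℤ := (s.take i).sum

/-- A basketball walk: every step lies in `{-2, -1, 1, 2}`. -/
def IsBasketball (s : List ℤ) : Prop := ∀ x ∈ s, x = -2 ∨ x = -1 ∨ x = 1 ∨ x = 2

/-- A C-walk: a basketball walk from 0 to 0 that visits 1 and is positive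
except at its extremities. -/
def IsCWalk (s : List ℤ) : Prop :=
  IsBasketball s ∧ ht s s.length = 0 ∧
    (∀ i, 0 < i → i < s.length → 0 < ht s i) ∧ ∃ i, i ≤ s.length ∧ ht s i = 1

/-- A G-walk: a basketball walk from 0 to 1 that is positive except at the origin. -/
def IsGWalk (s : List ℤ) : Prop :=
  IsBasketball s ∧ ht s s.length = 1 ∧ ∀ i, 1 ≤ i → i ≤ s.length → 0 < ht s i

/-- An A-walk (basketball excursion): a nonnegative basketball walk from 0 to 0. -/
def IsAWalk (s : List ℤ) : Prop :=
  IsBasketball s ∧ ht s s.length = 0 ∧ ∀ i, i ≤ s.length → 0 ≤ ht s i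

/-- A B-walk: a basketball walk from 0 to 1 that visits 0 and 1 only at its extremities. -/
def IsBWalk (s : List ℤ) : Prop :=
  IsBasketball s ∧ ht s s.length = 1 ∧
    ∀ i, 0 < i → i < s.length → ht s i ≠ 0 ∧ ht s i ≠ 1

/-- Number of `±1`-steps of a walk. -/
noncomputable def pmOneSteps (s : List ℤ) : ℕ :=
  Set.ncard {i : ℕ | i < s.length ∧ (s.getD i 0 = 1 ∨ s.getD i 0 = -1)}

/-- Number of steps that are odd `+2`-steps or even `-2`-steps
(the step of index `i`, 0-based, starts at height `ht s i`). -/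
noncomputable def lSteps (s : List ℤ) : ℕ :=
  Set.ncard {i : ℕ | i < s.length ∧
    ((s.getD i 0 = 2 ∧ Odd (ht s i)) ∨ (s.getD i 0 = -2 ∧ Even (ht s i)))}

/-- Number of steps that are odd `-2`-steps or even `+2`-steps. -/
noncomputable def rSteps (s : List ℤ) : ℕ :=
  Set.ncard {i : ℕ | i < s.length ∧
    ((s.getD i 0 = -2 ∧ Odd (ht s i)) ∨ (s.getD i 0 = 2 ∧ Even (ht s i)))}

/-- The (0-based) steps of indices `i < j` are paired: the `i`-th step is a `+2`,
the `j`-th step is a `-2`, the walk after step `j` is back at the height it had before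
step `i`, and strictly in between the walk stays at least one above that height. -/
def Paired (s : List ℤ) (i j : ℕ) : Prop :=
  i < j ∧ j < s.length ∧ s.getD i 0 = 2 ∧ s.getD j 0 = -2 ∧
    ht s (j + 1) = ht s i ∧ ∀ k, i + 1 < k → k ≤ j → ht s i + 1 ≤ ht s k

/-- A staggered `±2`-step: a `±2`-step that is not paired with any other `±2`-step. -/
def IsStaggered (s : List ℤ) (i : ℕ) : Prop :=
  i < s.length ∧ (s.getD i 0 = 2 ∨ s.getD i 0 = -2) ∧
    (∀ j, ¬ Paired s i j) ∧ ∀ j, ¬ Paired s j i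

/-- Number of staggered `±2`-steps of a walk. -/
noncomputable def staggeredCount (s : List ℤ) : ℕ :=
  Set.ncard {i : ℕ | IsStaggered s i}
/-- A sequence (list) avoids the pattern 213. -/
def Avoids213 (s : List ℕ) : Prop :=
  ∀ i1 i2 i3, i1 < i2 → i2 < i3 → i3 < s.length →
    ¬ (s.getD i2 0 < s.getD i1 0 ∧ s.getD i1 0 < s.getD i3 0)
/-- Labeled unary-binary trees: each vertex carries a label and has 0, 1 or 2 children. -/
inductive UBTree where
  | lf : ℕ → UBTree
  | un : ℕ → UBTree → UBTree
  | bin : ℕ → UBTree → UBTree → UBTree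

/-- Number of vertices. -/
def UBTree.size : UBTree → ℕ
  | .lf _ => 1
  | .un _ t => 1 + t.size
  | .bin _ l r => 1 + l.size + r.size

/-- Root label. -/
def UBTree.label : UBTree → ℕ
  | .lf a => a
  | .un a _ => a
  | .bin a _ _ => a

/-- Ordered list of children (subtrees) of the root. -/
def UBTree.children : UBTree → List UBTree
  | .lf _ => []
  | .un _ t => [t]
  | .bin _ l r => [l, r]

/-- The labeling is increasing: every child has a larger label than its parent. -/
def UBTree.increasing : UBTree → Prop
  | .lf _ => True
  | .un a t => a < t.label ∧ t.increasing
  | .bin a l r => a < l.label ∧ a < r.label ∧ l.increasing ∧ r.increasing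

/-- Number of unary nodes (vertices with exactly one child). -/
def UBTree.unaryCount : UBTree → ℕ
  | .lf _ => 0
  | .un _ t => 1 + t.unaryCount
  | .bin _ l r => l.unaryCount + r.unaryCount

/-- Breadth-first traversal of a queue of trees, recording `f` at each vertex;
the fuel bounds the number of vertices processed. -/
def bfsAux (f : UBTree → ℕ) : ℕ → List UBTree → List ℕ
  | 0, _ => []
  | _ + 1, [] => []
  | n + 1, t :: ts => f t :: bfsAux f n (ts ++ t.children)

/-- Labels of the tree read in left-to-right breadth-first search order
(the fuel `t.size` is exactly the number of vertices, hence suffices). -/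
def UBTree.bfs (t : UBTree) : List ℕ := bfsAux UBTree.label t.size [t]

/-- Arities (numbers of children) of the vertices read in left-to-right
breadth-first search order. -/
def UBTree.bfsArity (t : UBTree) : List ℕ :=
  bfsAux (fun t => t.children.length) t.size [t]

/-- An increasing unary-binary tree (vertices labeled bijectively with `1, ..., n`,
children having larger labels than their parents) whose associated permutation
(labels in breadth-first search order) avoids the pattern 213. -/
def IsGoodUB (t : UBTree) : Prop :=
  t.increasing ∧ t.bfs.Perm (List.range' 1 t.size) ∧ Avoids213 t.bfs

theorem ht_zero (s : List ℤ) : ht s 0 = 0 := by simp [ht]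

theorem ht_cons_succ (x : ℤ) (s : List ℤ) (i : ℕ) : ht (x :: s) (i + 1) = x + ht s i := by
  simp [ht]

theorem ht_length (s : List ℤ) : ht s s.length = s.sum := by simp [ht]

theorem ht_append_add (p s : List ℤ) (i : ℕ) : ht (p ++ s) (p.length + i) = p.sum + ht s i := by
  simp [ht, List.take_append, List.take_of_length_le]

/-- The step of index `j` is a `-2` which brings the walk to level `-l`, and the walk is above
that level up to this step. -/
def DownJumpAt (s : List ℤ) (l j : ℕ) : Prop :=
  j < s.length ∧ s.getD j 0 = -2 ∧ ht s (j + 1) = -l ∧ ∀ k ≤ j, -(l : ℤ) < ht s k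

/-- The walk first reaches a level at most `-l` by a `-2` ending exactly at `-l`. -/
def DownJump (s : List ℤ) (l : ℕ) : Prop := ∃ j, DownJumpAt s l j

theorem DownJumpAt.unique {s : List ℤ} {l j j' : ℕ} (h : DownJumpAt s l j)
    (h' : DownJumpAt s l j') : j = j' := by
  obtain ⟨-, -, h3, h4⟩ := h
  obtain ⟨-, -, h3', h4'⟩ := h'
  rcases lt_trichotomy j j' with hj | hj | hj
  · have := h4' (j + 1) hj
    omega
  · exact hj
  · have := h4 (j' + 1) hj
    omega

theorem downJumpAt_cons_succ {x : ℤ} {s : List ℤ} {l l' : ℕ} (hl : 1 ≤ l) (hx : l + x = l')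
    (j : ℕ) : DownJumpAt (x :: s) l (j + 1) ↔ DownJumpAt s l' j := by
  unfold DownJumpAt
  simp only [List.length_cons, List.getD_cons_succ, ht_cons_succ, Nat.add_lt_add_iff_right]
  refine and_congr_right fun _ => and_congr_right fun _ => and_congr (by omega) ?_
  constructor
  · intro h k hk
    have := h (k + 1) (by omega)
    rw [ht_cons_succ] at this
    omega
  · rintro h (_ | k) hk
    · rw [ht_zero]; omega
    · rw [ht_cons_succ]
      have := h k (by omega)
      omega

theorem downJump_cons {x : ℤ} {s : List ℤ} {l l' : ℕ} (hl : 1 ≤ l) (hx : l + x = l')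
    (h0 : x = -2 → l ≠ 2) : DownJump (x :: s) l ↔ DownJump s l' := by
  constructor
  · rintro ⟨_ | j, h⟩
    · obtain ⟨-, h2, h3, -⟩ := h
      simp only [List.getD_cons_zero] at h2
      rw [ht_cons_succ, ht_zero] at h3
      omega
    · exact ⟨j, (downJumpAt_cons_succ hl hx j).1 h⟩
  · rintro ⟨j, h⟩
    exact ⟨j + 1, (downJumpAt_cons_succ hl hx j).2 h⟩

theorem not_downJump_cons {x : ℤ} {s : List ℤ} {l : ℕ} (hx : l + x ≤ 0)
    (h0 : x = -2 → l ≠ 2) : ¬ DownJump (x :: s) l := by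
  rintro ⟨_ | j, h⟩
  · obtain ⟨-, h2, h3, -⟩ := h
    simp only [List.getD_cons_zero] at h2
    rw [ht_cons_succ, ht_zero] at h3
    omega
  · have := h.2.2.2 1 (by omega)
    rw [ht_cons_succ, ht_zero] at this
    omega

theorem downJump_neg_two_cons (s : List ℤ) : DownJump (-2 :: s) 2 := by
  refine ⟨0, by simp, by simp, by simp [ht_cons_succ, ht_zero], ?_⟩
  intro k hk
  obtain rfl : k = 0 := by omega
  simp [ht_zero]

theorem paired_cons_succ (x : ℤ) (s : List ℤ) (i j : ℕ) :
    Paired (x :: s) (i + 1) (j + 1) ↔ Paired s i j := by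
  unfold Paired
  simp only [List.length_cons, List.getD_cons_succ, ht_cons_succ, Nat.add_lt_add_iff_right,
    add_right_inj]
  refine and_congr_right fun _ => and_congr_right fun _ => and_congr_right fun _ =>
    and_congr_right fun _ => and_congr_right fun _ => ?_
  constructor
  · intro h k hk hkj
    have := h (k + 1) (by omega) (by omega)
    rw [ht_cons_succ] at this
    omega
  · rintro h (_ | k) hk hkj
    · omega
    · rw [ht_cons_succ]
      have := h k (by omega) (by omega)
      omega

theorem paired_zero_succ (x : ℤ) (s : List ℤ) (j : ℕ) :
    Paired (x :: s) 0 (j + 1) ↔ x = 2 ∧ DownJumpAt s 2 j := by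
  unfold Paired DownJumpAt
  simp only [List.length_cons, List.getD_cons_succ, List.getD_cons_zero, ht_cons_succ, ht_zero,
    Nat.add_lt_add_iff_right]
  constructor
  · rintro ⟨-, h1, h2, h3, h4, h5⟩
    refine ⟨h2, h1, h3, by push_cast; omega, ?_⟩
    rintro (_ | k) hk
    · simp [ht_zero]
    · have := h5 (k + 2) (by omega) (by omega)
      rw [ht_cons_succ] at this
      push_cast
      omega
  · rintro ⟨h2, h1, h3, h4, h5⟩
    refine ⟨by omega, h1, h2, h3, by push_cast at h4; omega, ?_⟩
    rintro (_ | k) hk hkj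
    · omega
    · have := h5 k (by omega)
      rw [ht_cons_succ]
      push_cast at this
      omega

theorem not_paired_zero (s : List ℤ) (i : ℕ) : ¬ Paired s i 0 := fun h => by
  have := h.1
  omega

theorem isStaggered_cons_succ (x : ℤ) (s : List ℤ) (i : ℕ) :
    IsStaggered (x :: s) (i + 1) ↔ IsStaggered s i ∧ ¬ (x = 2 ∧ DownJumpAt s 2 i) := by
  unfold IsStaggered
  simp only [List.length_cons, List.getD_cons_succ, Nat.add_lt_add_iff_right]
  constructor
  · rintro ⟨h1, h2, h3, h4⟩
    refine ⟨⟨h1, h2, fun j hj => h3 (j + 1) ((paired_cons_succ ..).2 hj),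
      fun j hj => h4 (j + 1) ((paired_cons_succ ..).2 hj)⟩, fun h => h4 0 ?_⟩
    exact (paired_zero_succ ..).2 h
  · rintro ⟨⟨h1, h2, h3, h4⟩, h5⟩
    refine ⟨h1, h2, ?_, ?_⟩
    · rintro (_ | j) hj
      · exact not_paired_zero _ _ hj
      · exact h3 j ((paired_cons_succ ..).1 hj)
    · rintro (_ | j) hj
      · exact h5 ((paired_zero_succ ..).1 hj)
      · exact h4 j ((paired_cons_succ ..).1 hj)

theorem isStaggered_cons_zero (x : ℤ) (s : List ℤ) :
    IsStaggered (x :: s) 0 ↔ (x = 2 ∨ x = -2) ∧ ¬ (x = 2 ∧ DownJump s 2) := by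
  unfold IsStaggered
  simp only [List.length_cons, List.getD_cons_zero, Nat.zero_lt_succ, true_and]
  refine and_congr_right fun _ => ⟨?_, ?_⟩
  · rintro ⟨h, -⟩ ⟨hx, j, hj⟩
    exact h (j + 1) ((paired_zero_succ ..).2 ⟨hx, hj⟩)
  · intro h
    refine ⟨?_, fun j => not_paired_zero _ _⟩
    rintro (_ | j) hj
    · exact not_paired_zero _ _ hj
    · have := (paired_zero_succ ..).1 hj
      exact h ⟨this.1, j, this.2⟩

theorem finite_isStaggered (s : List ℤ) : {i | IsStaggered s i}.Finite :=
  (Set.finite_lt_nat s.length).subset fun _ hi => hi.1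

theorem staggeredCount_cons_of_one {x : ℤ} (hx : x = 1 ∨ x = -1) (s : List ℤ) :
    staggeredCount (x :: s) = staggeredCount s := by
  unfold staggeredCount
  rw [← Set.ncard_image_of_injective {i | IsStaggered s i} (add_left_injective 1)]
  congr 1
  ext (_ | i)
  · simp [isStaggered_cons_zero]
    omega
  · simp only [Set.mem_ofPred_eq, isStaggered_cons_succ, Set.mem_image, Nat.add_right_cancel_iff,
      exists_eq_right, and_iff_left_iff_imp]
    omega

theorem staggeredCount_cons_of_two {x : ℤ} (hx : x = 2 ∨ x = -2) {s : List ℤ}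
    (h : x = 2 → ¬ DownJump s 2) :
    staggeredCount (x :: s) = staggeredCount s + 1 := by
  unfold staggeredCount
  rw [← Set.ncard_image_of_injective {i | IsStaggered s i} (add_left_injective 1),
    ← Set.ncard_insert_of_notMem (a := 0) (by simp) ((finite_isStaggered s).image _)]
  congr 1
  ext (_ | i)
  · simp [isStaggered_cons_zero]
    tauto
  · simp only [Set.mem_ofPred_eq, isStaggered_cons_succ, Set.mem_insert_iff, Set.mem_image,
      Nat.add_right_cancel_iff, exists_eq_right, Nat.add_eq_zero_iff, one_ne_zero, and_false,
      false_or, and_iff_left_iff_imp]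
    rintro - ⟨h1, h2⟩
    exact h h1 ⟨i, h2⟩

theorem staggeredCount_two_cons_of_downJump {s : List ℤ} (h : DownJump s 2) :
    staggeredCount (2 :: s) + 1 = staggeredCount s := by
  obtain ⟨j, hj⟩ := h
  have hmem : j ∈ {i | IsStaggered s i} := by
    refine ⟨hj.1, Or.inr hj.2.1, ?_, ?_⟩
    · intro j' hp
      have := hp.2.2.1
      have := hj.2.1
      omega
    · intro j' hp
      have h1 := hp.2.2.2.2.1
      have h2 := hj.2.2.2 j' hp.1.le
      have h3 := hj.2.2.1
      omega
  unfold staggeredCount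
  rw [← Set.ncard_sdiff_singleton_add_one hmem (finite_isStaggered s),
    ← Set.ncard_image_of_injective (_ \ _) (add_left_injective 1)]
  congr 2
  ext (_ | i)
  · simp only [Set.mem_ofPred_eq, isStaggered_cons_zero]
    simp
    exact ⟨j, hj⟩
  · simp only [Set.mem_ofPred_eq, isStaggered_cons_succ, Set.mem_image, Set.mem_sdiff,
      Nat.add_right_cancel_iff, exists_eq_right, true_and, Set.mem_singleton_iff]
    refine and_congr_right fun _ => not_congr ⟨fun h => h.unique hj, ?_⟩
    rintro rfl
    exact hj

/-- Weight of popping an element of the stack. -/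
def bitWeight {R : Type*} [CommSemiring R] (u : R) (b : Bool) : R := if b then u else 1

/-- Transfer recursion counting the ways to complete, in `k` steps prepended one after the other,
the end of a G-walk; the stack remembers, for each lower level, how this level is first reached. -/
def walkWeight {R : Type*} [CommSemiring R] (u : R) : ℕ → List Bool → R
  | 0, [] => 1
  | 0, _ :: _ => 0
  | _ + 1, [] => 0
  | k + 1, [b] => walkWeight u k [false, b] + walkWeight u k [false, true, b] +
      bitWeight u b * walkWeight u k []
  | k + 1, b :: b' :: c => walkWeight u k (false :: b :: b' :: c) +
      walkWeight u k (false :: true :: b :: b' :: c) +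
      bitWeight u b * walkWeight u k (b' :: c) +
      bitWeight u b * bitWeight u (!b') * walkWeight u k c

theorem map_bitWeight {R S : Type*} [CommSemiring R] [CommSemiring S] (f : R →+* S) (u : R)
    (b : Bool) : f (bitWeight u b) = bitWeight (f u) b := by
  cases b <;> simp [bitWeight]

theorem map_walkWeight {R S : Type*} [CommSemiring R] [CommSemiring S] (f : R →+* S) (u : R)
    (k : ℕ) (c : List Bool) : f (walkWeight u k c) = walkWeight (f u) k c := by
  induction k generalizing c with
  | zero => cases c <;> simp [walkWeight]
  | succ k ih =>
    match c with
    | [] => simp [walkWeight]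
    | [b] => simp [walkWeight, ih, map_bitWeight]
    | b :: b' :: c => simp [walkWeight, ih, map_bitWeight]

/-- `s` is an end of a G-walk with stack `c`, and `a` of its staggered steps are
staggered whatever happens before. -/
structure IsSuffix (s : List ℤ) (c : List Bool) (a : ℕ) : Prop where
  basketball : IsBasketball s
  sum_add : s.sum + c.length = 1
  pos : ∀ i, 1 ≤ i → i ≤ s.length → 0 < c.length + ht s i
  getD_iff : ∀ i, c.getD i false = true ↔ DownJump s (i + 1)
  stag : staggeredCount s = a + c.count true

/-- The ways to complete `s` into a G-walk with `M` staggered steps by prepending `k` steps. -/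
def completions (k : ℕ) (s : List ℤ) (M : ℕ) : Set (List ℤ) :=
  {p | p.length = k ∧ IsGWalk (p ++ s) ∧ staggeredCount (p ++ s) = M}

theorem IsSuffix.neg_one_cons {s : List ℤ} {c : List Bool} {a : ℕ} (h : IsSuffix s c a)
    (hc : c ≠ []) : IsSuffix (-1 :: s) (false :: c) a where
  basketball := by
    rintro x (_ | ⟨_, hx⟩)
    · simp
    · exact h.basketball x hx
  sum_add := by
    have := h.sum_add
    simp
    omega
  pos := by
    rintro (_ | i) h1 h2
    · omega
    · rw [ht_cons_succ]
      simp only [List.length_cons, Nat.add_le_add_iff_right] at h2 ⊢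
      rcases Nat.eq_zero_or_pos i with rfl | hi
      · rw [ht_zero]
        have := List.length_pos_iff.2 hc
        omega
      · have := h.pos i hi h2
        omega
  getD_iff := by
    rintro (_ | i)
    · simpa using not_downJump_cons (by norm_num) (by norm_num)
    · rw [List.getD_cons_succ, h.getD_iff]
      exact (downJump_cons (by omega) (by push_cast; ring) (by norm_num)).symm
  stag := by
    rw [staggeredCount_cons_of_one (Or.inr rfl), h.stag]
    simp

theorem IsSuffix.neg_two_cons {s : List ℤ} {c : List Bool} {a : ℕ} (h : IsSuffix s c a)
    (hc : c ≠ []) : IsSuffix (-2 :: s) (false :: true :: c) a where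
  basketball := by
    rintro x (_ | ⟨_, hx⟩)
    · simp
    · exact h.basketball x hx
  sum_add := by
    have := h.sum_add
    simp
    omega
  pos := by
    rintro (_ | i) h1 h2
    · omega
    · rw [ht_cons_succ]
      simp only [List.length_cons, Nat.add_le_add_iff_right] at h2 ⊢
      rcases Nat.eq_zero_or_pos i with rfl | hi
      · rw [ht_zero]
        have := List.length_pos_iff.2 hc
        omega
      · have := h.pos i hi h2
        omega
  getD_iff := by
    rintro (_ | _ | i)
    · simpa using not_downJump_cons (by norm_num) (by norm_num)
    · simpa using downJump_neg_two_cons s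
    · rw [List.getD_cons_succ, List.getD_cons_succ, h.getD_iff]
      exact (downJump_cons (by omega) (by push_cast; ring) (by omega)).symm
  stag := by
    rw [staggeredCount_cons_of_two (Or.inr rfl) (by norm_num), h.stag]
    simp
    ring

theorem IsSuffix.one_cons {s : List ℤ} {c : List Bool} {a : ℕ} {b : Bool}
    (h : IsSuffix s (b :: c) a) : IsSuffix (1 :: s) c (a + b.toNat) where
  basketball := by
    rintro x (_ | ⟨_, hx⟩)
    · simp
    · exact h.basketball x hx
  sum_add := by
    have := h.sum_add
    simp at this ⊢
    omega
  pos := by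
    rintro (_ | i) h1 h2
    · omega
    · rw [ht_cons_succ]
      simp only [List.length_cons, Nat.add_le_add_iff_right] at h2 ⊢
      rcases Nat.eq_zero_or_pos i with rfl | hi
      · rw [ht_zero]
        omega
      · have := h.pos i hi h2
        simp at this
        omega
  getD_iff := by
    intro i
    rw [downJump_cons (l' := i + 1 + 1) (by omega) (by push_cast; ring) (by norm_num),
      ← h.getD_iff, List.getD_cons_succ]
  stag := by
    rw [staggeredCount_cons_of_one (Or.inl rfl), h.stag]
    cases b <;> simp
    ring

theorem IsSuffix.two_cons {s : List ℤ} {c : List Bool} {a : ℕ} {b b' : Bool}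
    (h : IsSuffix s (b :: b' :: c) a) : IsSuffix (2 :: s) c (a + b.toNat + (!b').toNat) where
  basketball := by
    rintro x (_ | ⟨_, hx⟩)
    · simp
    · exact h.basketball x hx
  sum_add := by
    have := h.sum_add
    simp at this ⊢
    omega
  pos := by
    rintro (_ | i) h1 h2
    · omega
    · rw [ht_cons_succ]
      simp only [List.length_cons, Nat.add_le_add_iff_right] at h2 ⊢
      rcases Nat.eq_zero_or_pos i with rfl | hi
      · rw [ht_zero]
        omega
      · have := h.pos i hi h2
        simp at this
        omega
  getD_iff := by
    intro i
    rw [downJump_cons (l' := i + 2 + 1) (by omega) (by push_cast; ring) (by norm_num),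
      ← h.getD_iff, List.getD_cons_succ, List.getD_cons_succ]
  stag := by
    have hb := h.getD_iff 1
    have hs := h.stag
    simp only [List.getD_cons_succ, List.getD_cons_zero] at hb
    cases b'
    · rw [staggeredCount_cons_of_two (Or.inl rfl) (by simpa using hb), hs]
      cases b <;> simp <;> ring
    · have := staggeredCount_two_cons_of_downJump (hb.1 rfl)
      rw [hs] at this
      cases b <;> simp at this ⊢ <;> omega

theorem completions_zero (s : List ℤ) (M : ℕ) :
    completions 0 s M = {p | p = [] ∧ IsGWalk s ∧ staggeredCount s = M} := by
  ext p
  simp only [completions, Set.mem_ofPred_eq, List.length_eq_zero_iff]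
  refine and_congr_right ?_
  rintro rfl
  rfl

theorem IsGWalk.sum_eq {s : List ℤ} (h : IsGWalk s) : s.sum = 1 := by
  rw [← ht_length]
  exact h.2.1

theorem IsGWalk.sum_prefix_pos {p s : List ℤ} (h : IsGWalk (p ++ s)) (hp : p ≠ []) :
    0 < p.sum := by
  have := h.2.2 (p.length + 0) (List.length_pos_iff.2 hp) (by simp)
  rwa [ht_append_add, ht_zero, add_zero] at this

theorem completions_eq_empty {k : ℕ} {s : List ℤ} {M : ℕ} (h : 1 ≤ s.sum)
    (hk : s.sum ≠ 1 ∨ k ≠ 0) : completions k s M = ∅ := by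
  rw [Set.eq_empty_iff_forall_notMem]
  rintro p ⟨rfl, hp, -⟩
  have h1 := hp.sum_eq
  rw [List.sum_append] at h1
  rcases eq_or_ne p [] with rfl | hne
  · simp at h1 hk
    omega
  · have := hp.sum_prefix_pos hne
    omega

theorem disjoint_image_concat {x y : ℤ} (h : x ≠ y) (A B : Set (List ℤ)) :
    Disjoint ((· ++ [x]) '' A) ((· ++ [y]) '' B) := by
  rw [Set.disjoint_left]
  rintro _ ⟨p, -, rfl⟩ ⟨q, -, hq⟩
  simp only [List.append_singleton_inj] at hq
  exact h hq.2.symm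

theorem completions_succ (k : ℕ) (s : List ℤ) (M : ℕ) :
    (completions (k + 1) s M).encard = (completions k (-1 :: s) M).encard +
      (completions k (-2 :: s) M).encard + (completions k (1 :: s) M).encard +
      (completions k (2 :: s) M).encard := by
  have key : completions (k + 1) s M = (· ++ [-1]) '' completions k (-1 :: s) M ∪
      (· ++ [-2]) '' completions k (-2 :: s) M ∪ (· ++ [1]) '' completions k (1 :: s) M ∪
      (· ++ [2]) '' completions k (2 :: s) M := by
    ext p
    simp only [Set.mem_union, Set.mem_image]
    constructor
    · rintro ⟨h1, h2, h3⟩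
      rcases p.eq_nil_or_concat' with rfl | ⟨p, x, rfl⟩
      · simp at h1
      · have hx := h2.1 x (by simp)
        simp only [List.append_assoc, List.singleton_append] at h2 h3
        simp only [List.length_append, List.length_singleton, Nat.add_right_cancel_iff] at h1
        rcases hx with rfl | rfl | rfl | rfl
        · exact Or.inl (Or.inl (Or.inr ⟨p, ⟨h1, h2, h3⟩, rfl⟩))
        · exact Or.inl (Or.inl (Or.inl ⟨p, ⟨h1, h2, h3⟩, rfl⟩))
        · exact Or.inl (Or.inr ⟨p, ⟨h1, h2, h3⟩, rfl⟩)
        · exact Or.inr ⟨p, ⟨h1, h2, h3⟩, rfl⟩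
    · rintro (((⟨p, ⟨h1, h2, h3⟩, rfl⟩ | ⟨p, ⟨h1, h2, h3⟩, rfl⟩) | ⟨p, ⟨h1, h2, h3⟩, rfl⟩) |
        ⟨p, ⟨h1, h2, h3⟩, rfl⟩) <;>
      exact ⟨by simp [h1], by simpa using h2, by simpa using h3⟩
  have hinj (x : ℤ) : Function.Injective (fun p : List ℤ => p ++ [x]) :=
    List.append_left_injective [x]
  rw [key, Set.encard_union_eq, Set.encard_union_eq, Set.encard_union_eq,
    (hinj _).encard_image, (hinj _).encard_image, (hinj _).encard_image, (hinj _).encard_image]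
  · exact disjoint_image_concat (by norm_num) _ _
  · rw [Set.disjoint_union_left]
    exact ⟨disjoint_image_concat (by norm_num) _ _, disjoint_image_concat (by norm_num) _ _⟩
  · rw [Set.disjoint_union_left, Set.disjoint_union_left]
    exact ⟨⟨disjoint_image_concat (by norm_num) _ _, disjoint_image_concat (by norm_num) _ _⟩,
      disjoint_image_concat (by norm_num) _ _⟩

theorem X_pow_toNat (b : Bool) :
    (Polynomial.X : Polynomial ℕ) ^ b.toNat = bitWeight Polynomial.X b := by
  cases b <;> simp [bitWeight]

open Polynomial in
theorem encard_completions (k : ℕ) {s : List ℤ} {c : List Bool} {a : ℕ} (h : IsSuffix s c a)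
    (M : ℕ) :
    (completions k s M).encard = ((X ^ a * walkWeight (X : ℕ[X]) k c).coeff M : ℕ) := by
  induction k generalizing s c a with
  | zero =>
    match c with
    | [] =>
      have hs := h.stag
      have hG : IsGWalk s := by
        refine ⟨h.basketball, ?_, fun i h1 h2 => by simpa using h.pos i h1 h2⟩
        simpa [ht_length] using h.sum_add
      rw [completions_zero]
      simp only [List.count_nil, add_zero] at hs
      by_cases hM : a = M
      · subst hM
        simp [hG, hs, walkWeight]
      · simp [hs, hM, walkWeight, coeff_X_pow, Ne.symm hM]
    | b :: c =>
      rw [completions_zero]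
      have : ¬ IsGWalk s := fun hG => by
        have h1 := h.sum_add
        rw [hG.sum_eq] at h1
        simp at h1
        omega
      simp [this, walkWeight]
  | succ k ih =>
    match c with
    | [] =>
      have := h.sum_add
      rw [completions_eq_empty (by simp at this; omega) (by simp)]
      simp [walkWeight]
    | [b] =>
      have h1 := ih (h.neg_one_cons (by simp))
      have h2 := ih (h.neg_two_cons (by simp))
      have h3 := ih h.one_cons
      have h4 : completions k (2 :: s) M = ∅ := by
        have := h.sum_add
        simp at this
        exact completions_eq_empty (by simp; omega) (by simp; omega)
      rw [completions_succ, h1, h2, h3, h4, walkWeight, pow_add, X_pow_toNat]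
      simp [mul_add, mul_assoc]
    | b :: b' :: c =>
      have h1 := ih (h.neg_one_cons (by simp))
      have h2 := ih (h.neg_two_cons (by simp))
      have h3 := ih h.one_cons
      have h4 := ih h.two_cons
      rw [completions_succ, h1, h2, h3, h4, walkWeight, pow_add, pow_add, pow_add, X_pow_toNat,
        X_pow_toNat]
      simp [mul_add, mul_assoc]

theorem isSuffix_nil : IsSuffix [] [false] 0 where
  basketball := by simp [IsBasketball]
  sum_add := by simp
  pos := by simp; omega
  getD_iff := by
    intro i
    have : ¬ DownJump [] (i + 1) := by
      rintro ⟨j, hj, -⟩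
      simp at hj
    rcases i with _ | i <;> simpa using this
  stag := by simp [staggeredCount, IsStaggered]

open Polynomial in
theorem card_isGWalk (n m : ℕ) :
    Nat.card {s : List ℤ // IsGWalk s ∧ s.length = n ∧ staggeredCount s = m} =
      (walkWeight (X : ℕ[X]) n [false]).coeff m := by
  have h := encard_completions n isSuffix_nil m
  have h2 : completions n [] m = {s | IsGWalk s ∧ s.length = n ∧ staggeredCount s = m} := by
    ext s
    simp [completions]
    tauto
  rw [h2, pow_zero, one_mul] at h
  change Nat.card ↥{s | IsGWalk s ∧ s.length = n ∧ staggeredCount s = m} = _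
  rw [Nat.card_coe_set_eq, Set.ncard, h]
  simp

section Series

open PowerSeries

theorem PowerSeries.eq_zero_of_forall_X_pow_dvd {R : Type*} [CommRing R] {f : R⟦X⟧}
    (h : ∀ k, X ^ k ∣ f) : f = 0 := by
  ext n
  exact X_pow_dvd_iff.1 (h (n + 1)) n n.lt_succ_self

theorem PowerSeries.exists_X_pow_dvd_sub {R : Type*} [CommRing R] (f : ℕ → R⟦X⟧)
    (h : ∀ k, X ^ k ∣ f (k + 1) - f k) : ∃ F : R⟦X⟧, ∀ k, X ^ k ∣ F - f k := by
  have hle (k d : ℕ) : X ^ k ∣ f (k + d) - f k := by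
    induction d with
    | zero => simp
    | succ d ih =>
      have h1 := (pow_dvd_pow X (Nat.le_add_right k d)).trans (h (k + d))
      have := dvd_add h1 ih
      rwa [sub_add_sub_cancel, add_assoc] at this
  refine ⟨mk fun n => coeff n (f (n + 1)), fun k => X_pow_dvd_iff.2 fun n hn => ?_⟩
  obtain ⟨d, rfl⟩ := Nat.exists_eq_add_of_le (Nat.succ_le_of_lt hn)
  have := X_pow_dvd_iff.1 (hle (n + 1) d) n n.lt_succ_self
  rw [map_sub] at this ⊢
  rw [coeff_mk, sub_eq_zero]
  exact (sub_eq_zero.1 this).symm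

/-- The algebraic system satisfied by the generating functions. -/
theorem exists_series {R : Type*} [CommRing R] (u : R) :
    ∃ T P : R⟦X⟧, T = X * (P ^ 2 * (1 + C u * T)) ∧ P = 1 + X * (T * P ^ 2) := by
  let Φ : R⟦X⟧ × R⟦X⟧ → R⟦X⟧ × R⟦X⟧ := fun p =>
    (X * (p.2 ^ 2 * (1 + C u * p.1)), 1 + X * (p.1 * p.2 ^ 2))
  have hΦ (k : ℕ) (p q : R⟦X⟧ × R⟦X⟧) (h1 : X ^ k ∣ p.1 - q.1) (h2 : X ^ k ∣ p.2 - q.2) :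
      X ^ (k + 1) ∣ (Φ p).1 - (Φ q).1 ∧ X ^ (k + 1) ∣ (Φ p).2 - (Φ q).2 := by
    obtain ⟨a, ha⟩ := h1
    obtain ⟨b, hb⟩ := h2
    constructor
    · refine ⟨(p.2 + q.2) * (1 + C u * p.1) * b + q.2 ^ 2 * C u * a, ?_⟩
      linear_combination X * (p.2 + q.2) * (1 + C u * p.1) * hb + X * q.2 ^ 2 * C u * ha
    · refine ⟨(p.2 + q.2) * p.1 * b + q.2 ^ 2 * a, ?_⟩
      linear_combination X * (p.2 + q.2) * p.1 * hb + X * q.2 ^ 2 * ha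
  let f : ℕ → R⟦X⟧ × R⟦X⟧ := fun k => Φ^[k] (0, 0)
  have hf (k : ℕ) : f (k + 1) = Φ (f k) := Function.iterate_succ_apply' ..
  have hstep (k : ℕ) : X ^ k ∣ (f (k + 1)).1 - (f k).1 ∧ X ^ k ∣ (f (k + 1)).2 - (f k).2 := by
    induction k with
    | zero => simp
    | succ k ih =>
      rw [hf (k + 1)]
      nth_rw 2 [hf k]
      nth_rw 3 [hf k]
      exact hΦ k _ _ ih.1 ih.2
  obtain ⟨T, hT⟩ := exists_X_pow_dvd_sub (fun k => (f k).1) fun k => (hstep k).1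
  obtain ⟨P, hP⟩ := exists_X_pow_dvd_sub (fun k => (f k).2) fun k => (hstep k).2
  have hlim (k : ℕ) := hΦ k (T, P) (f k) (hT k) (hP k)
  refine ⟨T, P, sub_eq_zero.1 (eq_zero_of_forall_X_pow_dvd fun k => ?_),
    sub_eq_zero.1 (eq_zero_of_forall_X_pow_dvd fun k => ?_)⟩
  · have h1 := (pow_dvd_pow X k.le_succ).trans (hT (k + 1))
    have h2 := (pow_dvd_pow X k.le_succ).trans (hlim k).1
    rw [← hf] at h2
    simpa using dvd_sub h1 h2
  · have h1 := (pow_dvd_pow X k.le_succ).trans (hP (k + 1))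
    have h2 := (pow_dvd_pow X k.le_succ).trans (hlim k).2
    rw [← hf] at h2
    simpa using dvd_sub h1 h2

/-- Transfer recursion counting the ways to build a tree in `k` further steps from a queue of `q`
trees whose next label can be chosen in `N` ways. -/
def treeWeight {R : Type*} [CommSemiring R] (u : R) : ℕ → ℕ → ℕ → R
  | 0, q, _ => if q = 1 then 1 else 0
  | k + 1, q, N => ∑ j ∈ Finset.range N, treeWeight u k (q + 1) (j + 2) + u * treeWeight u k q 2 +
      if 2 ≤ q then treeWeight u k (q - 1) 2 else 0

theorem map_treeWeight {R S : Type*} [CommSemiring R] [CommSemiring S] (f : R →+* S) (u : R)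
    (k q N : ℕ) : f (treeWeight u k q N) = treeWeight (f u) k q N := by
  induction k generalizing q N with
  | zero => simp [treeWeight, apply_ite f]
  | succ k ih => simp [treeWeight, ih, apply_ite f]

variable {R : Type*} [CommRing R] {u : R} {T P : R⟦X⟧}

theorem treeWeight_eq_coeff (hT : T = X * (P ^ 2 * (1 + C u * T))) (hP : P = 1 + X * (T * P ^ 2))
    (k q N : ℕ) : treeWeight u k (q + 1) N = coeff k (T ^ q * (1 + C u * T) * P ^ N) := by
  have hsum (N : ℕ) : P ^ N = 1 + X * (T * ∑ j ∈ Finset.range N, P ^ (j + 2)) := by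
    induction N with
    | zero => simp
    | succ N ih =>
      rw [Finset.sum_range_succ]
      linear_combination ih + P ^ N * hP
  have key (q N : ℕ) : T ^ q * (1 + C u * T) * P ^ N = (if q = 0 then 1 else 0) + X *
      (∑ j ∈ Finset.range N, T ^ (q + 1) * (1 + C u * T) * P ^ (j + 2) +
        C u * (T ^ q * (1 + C u * T) * P ^ 2) +
        if 1 ≤ q then T ^ (q - 1) * (1 + C u * T) * P ^ 2 else 0) := by
    rw [← Finset.mul_sum]
    rcases q with _ | q
    · simp
      linear_combination (1 + C u * T) * hsum N + C u * hT
    · simp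
      linear_combination T ^ (q + 1) * (1 + C u * T) * hsum N + (C u * T ^ (q + 1) + T ^ q) * hT
  induction k generalizing q N with
  | zero =>
    rw [key]
    rcases q with _ | q <;> simp [treeWeight]
  | succ k ih =>
    rw [key, map_add, coeff_succ_X_mul]
    rcases q with _ | q
    · simp [treeWeight, ih, coeff_one]
    · simp [treeWeight, ih]

/-- Closed form for the generating function of `walkWeight`. -/
noncomputable def walkSeries (u : R) (T P : R⟦X⟧) : List Bool → R⟦X⟧
  | [] => 1
  | [b] => X * P ^ 2 * (bitWeight (C u) b + bitWeight (C u) (!b) * T)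
  | b :: b' :: c => X * P ^ 2 * (bitWeight (C u) b + bitWeight (C u) (!b) * T) *
      walkSeries u T P (b' :: c) +
      X * P ^ 2 * (bitWeight (C u) b * bitWeight (C u) (!b')) * walkSeries u T P c

theorem walkWeight_eq_coeff (hT : T = X * (P ^ 2 * (1 + C u * T)))
    (hP : P = 1 + X * (T * P ^ 2)) (k : ℕ) (c : List Bool) :
    walkWeight u k c = coeff k (walkSeries u T P c) := by
  have hA : P ^ 2 = 1 + X * P ^ 2 * (2 * T + X * P ^ 2 * T ^ 2) := by
    linear_combination (P + 1 + X * (T * P ^ 2)) * hP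
  have hf : bitWeight (C u) false = 1 := rfl
  have ht : bitWeight (C u) true = C u := rfl
  have aux (w w' Y Z : R⟦X⟧) : X * P ^ 2 * ((w + w' * T) * Y + Z) =
      X * (X * P ^ 2 * (1 + C u * T) * (X * P ^ 2 * ((w + w' * T) * Y + Z)) + X * P ^ 2 * w' * Y +
        (X * P ^ 2 * (1 + C u * T) * (X * P ^ 2 * (C u + T) *
          (X * P ^ 2 * ((w + w' * T) * Y + Z)) + X * P ^ 2 * (C u * w') * Y) +
          X * P ^ 2 * (X * P ^ 2 * ((w + w' * T) * Y + Z))) + w * Y + Z) := by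
    linear_combination X * ((w + w' * T) * Y + Z) * hA +
      X * (X * P ^ 2 * ((w + w' * T) * Y + Z) * (2 + X * P ^ 2 * (C u + T)) +
        w' * Y * (1 + X * P ^ 2 * C u)) * hT
  have key1 (b : Bool) : walkSeries u T P [b] = X * (walkSeries u T P [false, b] +
      walkSeries u T P [false, true, b] + bitWeight (C u) b * walkSeries u T P []) := by
    simp only [walkSeries, hf, ht, Bool.not_false, Bool.not_true]
    linear_combination aux (bitWeight (C u) b) (bitWeight (C u) (!b)) 1 0
  have key2 (b b' : Bool) (c : List Bool) : walkSeries u T P (b :: b' :: c) =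
      X * (walkSeries u T P (false :: b :: b' :: c) +
      walkSeries u T P (false :: true :: b :: b' :: c) +
      bitWeight (C u) b * walkSeries u T P (b' :: c) +
      bitWeight (C u) b * bitWeight (C u) (!b') * walkSeries u T P c) := by
    simp only [walkSeries, hf, ht, Bool.not_false, Bool.not_true]
    generalize walkSeries u T P (b' :: c) = Y
    generalize walkSeries u T P c = Z
    linear_combination aux (bitWeight (C u) b) (bitWeight (C u) (!b)) Y
      (bitWeight (C u) b * bitWeight (C u) (!b') * Z)
  have hw (b : Bool) : bitWeight (C u) b = C (bitWeight u b) := (map_bitWeight C u b).symm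
  induction k generalizing c with
  | zero =>
    match c with
    | [] => simp [walkWeight, walkSeries]
    | [b] => rw [key1, coeff_zero_X_mul, walkWeight]
    | b :: b' :: c => rw [key2, coeff_zero_X_mul, walkWeight]
  | succ k ih =>
    match c with
    | [] => simp [walkWeight, walkSeries, coeff_one]
    | [b] =>
      rw [key1, coeff_succ_X_mul, hw]
      simp [walkWeight, ih]
    | b :: b' :: c =>
      rw [key2, coeff_succ_X_mul, hw, hw, ← map_mul]
      simp only [map_add, coeff_C_mul, walkWeight, ih]

theorem walkWeight_eq_treeWeight (u : R) (n : ℕ) :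
    walkWeight u (n + 1) [false] = treeWeight u n 1 2 := by
  obtain ⟨T, P, hT, hP⟩ := exists_series u
  have h : walkSeries u T P [false] = X * (T ^ 0 * (1 + C u * T) * P ^ 2) := by
    simp [walkSeries, bitWeight]
    ring
  rw [walkWeight_eq_coeff hT hP, treeWeight_eq_coeff hT hP n 0 2, h, coeff_succ_X_mul]

end Series

/-- The increasing map of `ℕ` onto the complement of `v`. -/
def shiftAt (v l : ℕ) : ℕ := if l < v then l else l + 1

/-- The inverse of `shiftAt v`. -/
def unshiftAt (v l : ℕ) : ℕ := if l ≤ v then l else l - 1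

theorem shiftAt_lt_shiftAt {v x y : ℕ} : shiftAt v x < shiftAt v y ↔ x < y := by
  unfold shiftAt
  split_ifs <;> omega

theorem shiftAt_ne (v x : ℕ) : shiftAt v x ≠ v := by
  unfold shiftAt
  split_ifs <;> omega

theorem shiftAt_injective (v : ℕ) : Function.Injective (shiftAt v) :=
  (show StrictMono (shiftAt v) from fun _ _ => shiftAt_lt_shiftAt.2).injective

theorem unshiftAt_shiftAt (v x : ℕ) : unshiftAt v (shiftAt v x) = x := by
  unfold shiftAt unshiftAt
  split_ifs <;> omega

theorem shiftAt_unshiftAt {v x : ℕ} (h : x ≠ v) : shiftAt v (unshiftAt v x) = x := by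
  unfold shiftAt unshiftAt
  split_ifs <;> omega

theorem unshiftAt_lt_unshiftAt {v x y : ℕ} (hx : x ≠ v) (hy : y ≠ v) (h : x < y) :
    unshiftAt v x < unshiftAt v y := by
  unfold unshiftAt
  split_ifs <;> omega

theorem cons_map_shiftAt_perm {l : List ℕ} {k v : ℕ} (h : l.Perm (List.range' 1 k))
    (h1 : 1 ≤ v) (h2 : v ≤ k + 1) :
    (v :: l.map (shiftAt v)).Perm (List.range' 1 (k + 1)) := by
  rw [List.perm_ext_iff_of_nodup _ List.nodup_range']
  · intro x
    simp only [List.mem_cons, List.mem_map, h.mem_iff, List.mem_range'_1]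
    constructor
    · rintro (rfl | ⟨y, hy, rfl⟩)
      · omega
      · unfold shiftAt
        split_ifs <;> omega
    · intro hx
      by_cases hv : x = v
      · exact Or.inl hv
      · refine Or.inr ⟨unshiftAt v x, ?_, shiftAt_unshiftAt hv⟩
        unfold unshiftAt
        split_ifs <;> omega
  · refine List.nodup_cons.2 ⟨?_, (h.nodup_iff.2 List.nodup_range').map (shiftAt_injective v)⟩
    rw [List.mem_map]
    rintro ⟨y, -, hy⟩
    exact shiftAt_ne v y hy

theorem map_unshiftAt_perm {l : List ℕ} {k v : ℕ}
    (h : (v :: l.map (shiftAt v)).Perm (List.range' 1 (k + 1))) :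
    l.Perm (List.range' 1 k) := by
  have hnd := h.nodup_iff.2 List.nodup_range'
  have hv := h.mem_iff.1 (List.mem_cons_self)
  rw [List.mem_range'_1] at hv
  rw [List.perm_ext_iff_of_nodup (List.nodup_cons.1 hnd).2.of_map List.nodup_range']
  intro x
  have hx : x ∈ l ↔ shiftAt v x ∈ v :: l.map (shiftAt v) := by
    rw [List.mem_cons, or_iff_right (shiftAt_ne v x),
      List.mem_map_of_injective (shiftAt_injective v)]
  rw [hx, h.mem_iff, List.mem_range'_1, List.mem_range'_1]
  unfold shiftAt
  split_ifs <;> omega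

theorem avoids213_cons {a : ℕ} {l : List ℕ} :
    Avoids213 (a :: l) ↔ l.Pairwise (fun x y => ¬ (x < a ∧ a < y)) ∧ Avoids213 l := by
  constructor
  · intro h
    constructor
    · rw [List.pairwise_iff_getElem]
      intro i j hi hj hij
      have := h 0 (i + 1) (j + 1) (by omega) (by omega) (by simpa using hj)
      simpa [hi, hj] using this
    · intro i1 i2 i3 h1 h2 h3
      simpa using h (i1 + 1) (i2 + 1) (i3 + 1) (by omega) (by omega) (by simpa using h3)
  · rintro ⟨hp, hl⟩ (_ | i1) (_ | i2) (_ | i3) h1 h2 h3 <;> try omega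
    · rw [List.pairwise_iff_getElem] at hp
      simp only [List.length_cons, Nat.add_lt_add_iff_right] at h2 h3
      have hi2 := h2.trans h3
      simpa [h3, hi2] using hp i2 i3 hi2 h3 h2
    · simpa using hl i1 i2 i3 (by omega) (by omega) (by simpa using h3)

theorem avoids213_map_shiftAt {v : ℕ} {l : List ℕ} :
    Avoids213 (l.map (shiftAt v)) ↔ Avoids213 l := by
  unfold Avoids213
  simp only [List.length_map]
  refine forall_congr' fun i1 => forall_congr' fun i2 => forall_congr' fun i3 =>
    forall_congr' fun h1 => forall_congr' fun h2 => forall_congr' fun h3 => ?_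
  have h2' := h2.trans h3
  have h1' := h1.trans h2'
  simp [h1', h2', h3, shiftAt_lt_shiftAt]

/-- The values `w` such that a new first element of rank `w` creates no pattern 213. -/
def cuts (l : List ℕ) : Finset ℕ :=
  (Finset.Icc 1 (l.length + 1)).filter fun w => l.Pairwise fun x y => ¬ (x < w ∧ w ≤ y)

theorem mem_cuts {l : List ℕ} {w : ℕ} : w ∈ cuts l ↔
    (1 ≤ w ∧ w ≤ l.length + 1) ∧ l.Pairwise fun x y => ¬ (x < w ∧ w ≤ y) := by
  simp [cuts]

theorem avoids213_cons_map_shiftAt {v : ℕ} {l : List ℕ} :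
    Avoids213 (v :: l.map (shiftAt v)) ↔
      l.Pairwise (fun x y => ¬ (x < v ∧ v ≤ y)) ∧ Avoids213 l := by
  rw [avoids213_cons, avoids213_map_shiftAt, List.pairwise_map]
  refine and_congr_left fun _ => iff_of_eq ?_
  congr 1
  ext x y
  unfold shiftAt
  split_ifs <;> omega

theorem one_mem_cuts {l : List ℕ} (h : l.Perm (List.range' 1 l.length)) : 1 ∈ cuts l := by
  refine mem_cuts.2 ⟨by omega, List.pairwise_of_forall_mem_list fun x hx y _ => ?_⟩
  rw [h.mem_iff, List.mem_range'_1] at hx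
  omega

theorem cuts_cons_map_shiftAt {v : ℕ} {l : List ℕ} (h : l.Perm (List.range' 1 l.length))
    (hv : v ∈ cuts l) : cuts (v :: l.map (shiftAt v)) =
      insert (l.length + 2) ((cuts l).filter (· ≤ v)) := by
  have hv' := (mem_cuts.1 hv).1
  ext w
  simp only [mem_cuts, Finset.mem_insert, Finset.mem_filter, List.length_cons, List.length_map,
    List.pairwise_cons, List.pairwise_map]
  have hmem (y : ℕ) : y ∈ l ↔ 1 ≤ y ∧ y ≤ l.length := by
    rw [h.mem_iff, List.mem_range'_1]
    omega
  by_cases hw : w ≤ v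
  · have : l.Pairwise (fun x y => ¬ (shiftAt v x < w ∧ w ≤ shiftAt v y)) ↔
        l.Pairwise (fun x y => ¬ (x < w ∧ w ≤ y)) := by
      refine iff_of_eq ?_
      congr 1
      ext x y
      unfold shiftAt
      split_ifs <;> omega
    rw [this]
    constructor
    · rintro ⟨h1, -, h3⟩
      exact Or.inr ⟨⟨by omega, h3⟩, hw⟩
    · rintro (h1 | ⟨⟨h1, h2⟩, -⟩)
      · omega
      · exact ⟨by omega, fun y _ hy => by omega, h2⟩
  · constructor
    · rintro ⟨h1, h2, -⟩
      left
      by_contra hne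
      refine h2 (shiftAt v (w - 1)) (List.mem_map_of_mem ((hmem _).2 (by omega))) ⟨by omega, ?_⟩
      unfold shiftAt
      split_ifs <;> omega
    · rintro (rfl | h1)
      · have hb (y : ℕ) (hy : y ∈ l) : shiftAt v y ≤ l.length + 1 := by
          rw [hmem] at hy
          unfold shiftAt
          split_ifs <;> omega
        refine ⟨by omega, ?_, List.pairwise_of_forall_mem_list fun x _ y hy => ?_⟩
        · intro z hz
          obtain ⟨y, hy, rfl⟩ := List.mem_map.1 hz
          have := hb y hy
          omega
        · have := hb y hy
          omega
      · exact absurd h1.2 hw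

theorem card_cuts_cons_map_shiftAt {v : ℕ} {l : List ℕ} (h : l.Perm (List.range' 1 l.length))
    (hv : v ∈ cuts l) : (cuts (v :: l.map (shiftAt v))).card =
      ((cuts l).filter (· ≤ v)).card + 1 := by
  rw [cuts_cons_map_shiftAt h hv, Finset.card_insert_of_notMem]
  intro hc
  have := (mem_cuts.1 (Finset.mem_filter.1 hc).1).1
  omega

theorem sum_card_filter_le {M : Type*} [AddCommMonoid M] (s : Finset ℕ) (g : ℕ → M) :
    ∑ v ∈ s, g (s.filter (· ≤ v)).card = ∑ j ∈ Finset.range s.card, g (j + 1) := by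
  induction s using Finset.induction_on_max with
  | empty => simp
  | insert a s ha ih =>
    have has : a ∉ s := fun h => (ha a h).false
    rw [Finset.sum_insert has, Finset.card_insert_of_notMem has, Finset.sum_range_succ, ← ih,
      add_comm]
    congr 1
    · refine Finset.sum_congr rfl fun v hv => ?_
      rw [Finset.filter_insert, if_neg (ha v hv).not_ge]
    · rw [Finset.filter_true_of_mem, Finset.card_insert_of_notMem has]
      intro x hx
      rcases Finset.mem_insert.1 hx with rfl | hx
      · exact le_rfl
      · exact (ha x hx).le

namespace UBTree

/-- Apply `f` to all labels. -/
def mapLabels (f : ℕ → ℕ) : UBTree → UBTree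
  | .lf a => .lf (f a)
  | .un a t => .un (f a) (t.mapLabels f)
  | .bin a l r => .bin (f a) (l.mapLabels f) (r.mapLabels f)

/-- Labels in preorder. -/
def labels : UBTree → List ℕ
  | .lf a => [a]
  | .un a t => a :: t.labels
  | .bin a l r => a :: (l.labels ++ r.labels)

@[simp]
theorem label_mapLabels (f : ℕ → ℕ) (t : UBTree) : (t.mapLabels f).label = f t.label := by
  cases t <;> rfl

@[simp]
theorem size_mapLabels (f : ℕ → ℕ) (t : UBTree) : (t.mapLabels f).size = t.size := by
  induction t <;> simp_all [mapLabels, size]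

@[simp]
theorem unaryCount_mapLabels (f : ℕ → ℕ) (t : UBTree) :
    (t.mapLabels f).unaryCount = t.unaryCount := by
  induction t <;> simp_all [mapLabels, unaryCount]

theorem children_mapLabels (f : ℕ → ℕ) (t : UBTree) :
    (t.mapLabels f).children = t.children.map (mapLabels f) := by
  cases t <;> rfl

theorem mapLabels_mapLabels (f g : ℕ → ℕ) (t : UBTree) :
    (t.mapLabels f).mapLabels g = t.mapLabels fun a => g (f a) := by
  induction t <;> simp_all [mapLabels]

theorem mapLabels_eq_self {f : ℕ → ℕ} {t : UBTree} (h : ∀ a ∈ t.labels, f a = a) :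
    t.mapLabels f = t := by
  induction t with
  | lf a => simp_all [mapLabels, labels]
  | un a t ih => simp_all [mapLabels, labels]
  | bin a l r ihl ihr =>
    simp only [labels, List.mem_cons, List.mem_append, forall_eq_or_imp] at h
    rw [mapLabels, h.1, ihl fun a ha => h.2 a (Or.inl ha), ihr fun a ha => h.2 a (Or.inr ha)]

theorem label_mem_labels (t : UBTree) : t.label ∈ t.labels := by
  cases t <;> simp [label, labels]

theorem labels_eq (t : UBTree) : t.labels = t.label :: t.children.flatMap labels := by
  cases t <;> simp [label, labels, children]

theorem size_eq (t : UBTree) : t.size = (t.children.map size).sum + 1 := by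
  cases t <;> simp [size, children] <;> ring

theorem increasing_iff (t : UBTree) :
    t.increasing ↔ ∀ c ∈ t.children, t.label < c.label ∧ c.increasing := by
  cases t <;> simp [increasing, children, label]
  tauto

theorem increasing.mapLabels {f : ℕ → ℕ} {t : UBTree} (ht : t.increasing)
    (h : ∀ a ∈ t.labels, ∀ b ∈ t.labels, a < b → f a < f b) : (t.mapLabels f).increasing := by
  induction t with
  | lf a => trivial
  | un a t ih =>
    simp only [increasing, UBTree.mapLabels, labels, List.mem_cons, label_mapLabels] at *
    exact ⟨h _ (Or.inl rfl) _ (Or.inr t.label_mem_labels) ht.1,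
      ih ht.2 fun a ha b hb => h a (Or.inr ha) b (Or.inr hb)⟩
  | bin a l r ihl ihr =>
    simp only [increasing, UBTree.mapLabels, labels, List.mem_cons, List.mem_append,
      label_mapLabels] at *
    exact ⟨h _ (Or.inl rfl) _ (Or.inr (Or.inl l.label_mem_labels)) ht.1,
      h _ (Or.inl rfl) _ (Or.inr (Or.inr r.label_mem_labels)) ht.2.1,
      ihl ht.2.2.1 fun a ha b hb => h a (Or.inr (Or.inl ha)) b (Or.inr (Or.inl hb)),
      ihr ht.2.2.2 fun a ha b hb => h a (Or.inr (Or.inr ha)) b (Or.inr (Or.inr hb))⟩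

end UBTree

open UBTree

/-- Number of vertices of a queue of trees. -/
def queueSize (Q : List UBTree) : ℕ := (Q.map size).sum

/-- Number of unary nodes of a queue of trees. -/
def queueUnary (Q : List UBTree) : ℕ := (Q.map unaryCount).sum

/-- Labels of a queue of trees in breadth-first search order. -/
def queueBfs (Q : List UBTree) : List ℕ := bfsAux label (queueSize Q) Q

theorem queueSize_cons (t : UBTree) (ts : List UBTree) :
    queueSize (t :: ts) = queueSize (ts ++ t.children) + 1 := by
  simp [queueSize, t.size_eq]
  ring

theorem queueBfs_cons (t : UBTree) (ts : List UBTree) :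
    queueBfs (t :: ts) = t.label :: queueBfs (ts ++ t.children) := by
  rw [queueBfs, queueSize_cons, bfsAux, queueBfs]

theorem queueSize_map_mapLabels (f : ℕ → ℕ) (Q : List UBTree) :
    queueSize (Q.map (mapLabels f)) = queueSize Q := by
  simp [queueSize, Function.comp_def]

theorem queueUnary_map_mapLabels (f : ℕ → ℕ) (Q : List UBTree) :
    queueUnary (Q.map (mapLabels f)) = queueUnary Q := by
  simp [queueUnary, Function.comp_def]

/-- Induction removing the first tree of the queue and adding its children at the end. -/
theorem queue_induction {p : List UBTree → Prop} (nil : p [])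
    (cons : ∀ t ts, p (ts ++ t.children) → p (t :: ts)) (Q : List UBTree) : p Q := by
  induction hk : queueSize Q using Nat.strong_induction_on generalizing Q with
  | _ k ih =>
    rcases Q with _ | ⟨t, ts⟩
    · exact nil
    · rw [queueSize_cons] at hk
      exact cons t ts (ih _ (by omega) _ rfl)

theorem queueBfs_map_mapLabels (f : ℕ → ℕ) (Q : List UBTree) :
    queueBfs (Q.map (mapLabels f)) = (queueBfs Q).map f := by
  induction Q using queue_induction with
  | nil => rfl
  | cons t ts ih =>
    rw [List.map_cons, queueBfs_cons, queueBfs_cons, children_mapLabels, ← List.map_append, ih]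
    simp

theorem queueBfs_perm (Q : List UBTree) : (queueBfs Q).Perm (Q.flatMap labels) := by
  induction Q using queue_induction with
  | nil => rfl
  | cons t ts ih =>
    rw [queueBfs_cons, List.flatMap_cons, labels_eq, List.cons_append]
    refine (ih.trans ?_).cons _
    rw [List.flatMap_append]
    exact List.perm_append_comm

theorem length_queueBfs (Q : List UBTree) : (queueBfs Q).length = queueSize Q := by
  induction Q using queue_induction with
  | nil => rfl
  | cons t ts ih => rw [queueBfs_cons, List.length_cons, ih, queueSize_cons]

theorem mem_queueBfs {Q : List UBTree} {t : UBTree} (ht : t ∈ Q) {a : ℕ} (ha : a ∈ t.labels) :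
    a ∈ queueBfs Q := by
  rw [(queueBfs_perm Q).mem_iff]
  exact List.mem_flatMap.2 ⟨t, ht, ha⟩

/-- A queue of increasing trees whose associated permutation avoids 213. -/
structure IsGoodQueue (Q : List UBTree) : Prop where
  increasing : ∀ t ∈ Q, t.increasing
  perm : (queueBfs Q).Perm (List.range' 1 (queueBfs Q).length)
  avoids : Avoids213 (queueBfs Q)

theorem isGoodUB_iff (t : UBTree) : IsGoodUB t ↔ IsGoodQueue [t] := by
  have h1 : queueSize [t] = t.size := by simp [queueSize]
  have h2 : t.bfs = queueBfs [t] := by rw [UBTree.bfs, queueBfs, h1]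
  constructor
  · rintro ⟨h3, h4, h5⟩
    rw [h2] at h4 h5
    exact ⟨by simpa using h3, by rwa [length_queueBfs, h1], h5⟩
  · rintro ⟨h3, h4, h5⟩
    rw [length_queueBfs, h1] at h4
    exact ⟨by simpa using h3, by rwa [h2], by rwa [h2]⟩

/-- Process the first tree of the queue and standardize the labels of the rest. -/
def popQueue : List UBTree → List UBTree
  | [] => []
  | t :: ts => (ts ++ t.children).map (mapLabels (unshiftAt t.label))

theorem map_mapLabels_shiftAt_unshiftAt {v : ℕ} {L : List UBTree} (h : v ∉ queueBfs L) :
    (L.map (mapLabels (unshiftAt v))).map (mapLabels (shiftAt v)) = L := by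
  rw [List.map_map]
  refine (List.map_congr_left fun t ht => ?_).trans (List.map_id L)
  rw [Function.comp_apply, mapLabels_mapLabels]
  refine mapLabels_eq_self fun a ha => shiftAt_unshiftAt ?_
  rintro rfl
  exact h (mem_queueBfs ht ha)

theorem map_mapLabels_unshiftAt_shiftAt (v : ℕ) (L : List UBTree) :
    (L.map (mapLabels (shiftAt v))).map (mapLabels (unshiftAt v)) = L := by
  rw [List.map_map]
  refine (List.map_congr_left fun t _ => ?_).trans (List.map_id L)
  rw [Function.comp_apply, mapLabels_mapLabels]
  exact mapLabels_eq_self fun a _ => unshiftAt_shiftAt v a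

theorem popQueue_eq {t : UBTree} {ts Q : List UBTree}
    (h : ts ++ t.children = Q.map (mapLabels (shiftAt t.label))) : popQueue (t :: ts) = Q := by
  rw [popQueue, h, map_mapLabels_unshiftAt_shiftAt]

theorem IsGoodQueue.append_children {t : UBTree} {ts : List UBTree} (h : IsGoodQueue (t :: ts)) :
    ts ++ t.children = (popQueue (t :: ts)).map (mapLabels (shiftAt t.label)) := by
  have hnd := h.perm.nodup_iff.2 List.nodup_range'
  rw [queueBfs_cons] at hnd
  exact (map_mapLabels_shiftAt_unshiftAt (List.nodup_cons.1 hnd).1).symm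

theorem queueBfs_cons_of_append_children {t : UBTree} {ts Q : List UBTree}
    (h : ts ++ t.children = Q.map (mapLabels (shiftAt t.label))) :
    queueBfs (t :: ts) = t.label :: (queueBfs Q).map (shiftAt t.label) := by
  rw [queueBfs_cons, h, queueBfs_map_mapLabels]

theorem queueSize_popQueue (Q : List UBTree) : queueSize (popQueue Q) = queueSize Q - 1 := by
  rcases Q with _ | ⟨t, ts⟩
  · rfl
  · rw [popQueue, queueSize_map_mapLabels, queueSize_cons, Nat.add_sub_cancel]

theorem IsGoodQueue.label_mem_cuts {t : UBTree} {ts : List UBTree} (h : IsGoodQueue (t :: ts)) :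
    t.label ∈ cuts (queueBfs (popQueue (t :: ts))) := by
  have hb := queueBfs_cons_of_append_children h.append_children
  have hp := h.perm
  have ha := h.avoids
  rw [hb] at hp ha
  have hl := hp.mem_iff.1 List.mem_cons_self
  rw [List.mem_range'_1, List.length_cons, List.length_map] at hl
  exact mem_cuts.2 ⟨by omega, (avoids213_cons_map_shiftAt.1 ha).1⟩

theorem IsGoodQueue.popQueue {Q : List UBTree} (h : IsGoodQueue Q) :
    IsGoodQueue (popQueue Q) := by
  rcases Q with _ | ⟨t, ts⟩
  · exact h
  have hb := queueBfs_cons_of_append_children h.append_children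
  have hp := h.perm
  have ha := h.avoids
  rw [hb] at hp ha
  rw [List.length_cons, List.length_map] at hp
  have hnd := h.perm.nodup_iff.2 List.nodup_range'
  rw [queueBfs_cons] at hnd
  have hnot := (List.nodup_cons.1 hnd).1
  refine ⟨?_, map_unshiftAt_perm hp, (avoids213_cons_map_shiftAt.1 ha).2⟩
  intro t' ht'
  obtain ⟨c, hc, rfl⟩ := List.mem_map.1 ht'
  have hne (a : ℕ) (ha : a ∈ c.labels) : a ≠ t.label := by
    rintro rfl
    exact hnot (mem_queueBfs hc ha)
  refine increasing.mapLabels ?_ fun a ha b hb => unshiftAt_lt_unshiftAt (hne a ha) (hne b hb)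
  rcases List.mem_append.1 hc with hc | hc
  · exact h.increasing c (List.mem_cons_of_mem _ hc)
  · exact ((increasing_iff t).1 (h.increasing t List.mem_cons_self) c hc).2

theorem IsGoodQueue.cons {t : UBTree} {ts Q : List UBTree} (h : IsGoodQueue Q)
    (hv : t.label ∈ cuts (queueBfs Q))
    (hQ : ts ++ t.children = Q.map (mapLabels (shiftAt t.label)))
    (hinc : ∀ c ∈ t.children, t.label < c.label) : IsGoodQueue (t :: ts) := by
  have hinc' (c : UBTree) (hc : c ∈ ts ++ t.children) : c.increasing := by
    rw [hQ] at hc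
    obtain ⟨d, hd, rfl⟩ := List.mem_map.1 hc
    exact (h.increasing d hd).mapLabels fun a _ b _ => shiftAt_lt_shiftAt.2
  have hv' := mem_cuts.1 hv
  constructor
  · intro t' ht'
    rcases List.mem_cons.1 ht' with rfl | ht'
    · exact (increasing_iff _).2 fun c hc =>
        ⟨hinc c hc, hinc' c (List.mem_append_right _ hc)⟩
    · exact hinc' _ (List.mem_append_left _ ht')
  · rw [queueBfs_cons_of_append_children hQ, List.length_cons, List.length_map]
    exact cons_map_shiftAt_perm h.perm hv'.1.1 hv'.1.2
  · rw [queueBfs_cons_of_append_children hQ]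
    exact avoids213_cons_map_shiftAt.2 ⟨hv'.2, h.avoids⟩

/-- A good queue such that the label of its last tree is smaller than every cut except `1`. -/
structure IsBuildable (Q : List UBTree) : Prop extends IsGoodQueue Q where
  eq_one : ∀ Q₀ c, Q = Q₀ ++ [c] → ∀ w ∈ cuts (queueBfs Q), w ≤ c.label → w = 1

/-- The good one-tree queues with `M` unary nodes that reduce to `Q` in `j` steps. -/
def treeCompletions (j : ℕ) (Q : List UBTree) (M : ℕ) : Set (List UBTree) :=
  {S | S.length = 1 ∧ IsGoodQueue S ∧ queueUnary S = M ∧ popQueue^[j] S = Q}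

/-- Add a leaf labeled `v` in front of the queue. -/
def leafExt (Q : List UBTree) (v : ℕ) : List UBTree := .lf v :: Q.map (mapLabels (shiftAt v))

/-- Make the last tree `c` of the queue the child of a new first tree. -/
def unExt (Q : List UBTree) (c : UBTree) : List UBTree :=
  .un 1 (c.mapLabels (shiftAt 1)) :: Q.map (mapLabels (shiftAt 1))

/-- Make the last two trees `l`, `r` of the queue the children of a new first tree. -/
def binExt (Q : List UBTree) (l r : UBTree) : List UBTree :=
  .bin 1 (l.mapLabels (shiftAt 1)) (r.mapLabels (shiftAt 1)) :: Q.map (mapLabels (shiftAt 1))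

theorem popQueue_leafExt (Q : List UBTree) (v : ℕ) : popQueue (leafExt Q v) = Q :=
  popQueue_eq (by simp [children, label])

theorem popQueue_unExt (Q : List UBTree) (c : UBTree) : popQueue (unExt Q c) = Q ++ [c] :=
  popQueue_eq (by simp [children, label])

theorem popQueue_binExt (Q : List UBTree) (l r : UBTree) :
    popQueue (binExt Q l r) = Q ++ [l, r] :=
  popQueue_eq (by simp [children, label])

theorem IsGoodQueue.label_mem {Q : List UBTree} (h : IsGoodQueue Q) {t : UBTree} (ht : t ∈ Q) :
    1 ≤ t.label ∧ t.label ≤ (queueBfs Q).length := by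
  have := h.perm.mem_iff.1 (mem_queueBfs ht t.label_mem_labels)
  rw [List.mem_range'_1] at this
  omega

theorem IsBuildable.leafExt {Q : List UBTree} (h : IsBuildable Q) (hQ : Q ≠ []) {v : ℕ}
    (hv : v ∈ cuts (queueBfs Q)) : IsBuildable (leafExt Q v) where
  toIsGoodQueue := h.toIsGoodQueue.cons hv (by simp [children, label]) (by simp [children])
  eq_one := by
    intro Q₀ c hc w hw hwc
    obtain ⟨Q, d, rfl⟩ := Q.eq_nil_or_concat'.resolve_left hQ
    rw [_root_.leafExt, List.map_append, List.map_singleton, ← List.cons_append,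
      List.append_singleton_inj] at hc
    obtain ⟨-, rfl⟩ := hc
    rw [_root_.leafExt, queueBfs_cons_of_append_children (Q := Q ++ [d])
      (by simp [children, label]), label, cuts_cons_map_shiftAt h.perm hv, Finset.mem_insert,
      Finset.mem_filter] at hw
    have hd := h.label_mem (t := d) (by simp)
    rw [label_mapLabels] at hwc
    rcases hw with rfl | ⟨hw, hwv⟩
    · unfold shiftAt at hwc
      split_ifs at hwc <;> omega
    · refine h.eq_one _ _ rfl w hw ?_
      unfold shiftAt at hwc
      split_ifs at hwc <;> omega

theorem card_cuts_leafExt {Q : List UBTree} (h : IsBuildable Q) {v : ℕ}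
    (hv : v ∈ cuts (queueBfs Q)) : (cuts (queueBfs (leafExt Q v))).card =
      ((cuts (queueBfs Q)).filter (· ≤ v)).card + 1 := by
  rw [leafExt, queueBfs_cons_of_append_children (Q := Q) (by simp [children, label]), label,
    card_cuts_cons_map_shiftAt h.perm hv]

theorem filter_cuts_le_one {l : List ℕ} (h : l.Perm (List.range' 1 l.length)) :
    (cuts l).filter (· ≤ 1) = {1} := by
  ext w
  rw [Finset.mem_filter, Finset.mem_singleton]
  constructor
  · rintro ⟨h1, h2⟩
    have := (mem_cuts.1 h1).1
    omega
  · rintro rfl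
    exact ⟨one_mem_cuts h, le_rfl⟩

/-- Adding a first tree whose root is labeled `1` and has the last trees as children. -/
theorem IsGoodQueue.cons_one {Q ts : List UBTree} {t : UBTree} (h : IsGoodQueue Q)
    (ht : t.label = 1) (hQ : ts ++ t.children = Q.map (mapLabels (shiftAt 1))) :
    IsBuildable (t :: ts) ∧ (cuts (queueBfs (t :: ts))).card = 2 := by
  have hQ' : ts ++ t.children = Q.map (mapLabels (shiftAt t.label)) := by rw [ht, hQ]
  have h1 := one_mem_cuts h.perm
  have hgood : IsGoodQueue (t :: ts) := by
    refine h.cons (by rwa [ht]) hQ' fun c hc => ?_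
    have hc' : c ∈ ts ++ t.children := List.mem_append_right _ hc
    rw [hQ] at hc'
    obtain ⟨d, hd, rfl⟩ := List.mem_map.1 hc'
    have := (h.label_mem hd).1
    rw [ht, label_mapLabels, shiftAt]
    split_ifs <;> omega
  have hb : queueBfs (t :: ts) = 1 :: (queueBfs Q).map (shiftAt 1) := by
    rw [queueBfs_cons_of_append_children hQ', ht]
  refine ⟨⟨hgood, ?_⟩, ?_⟩
  · intro Q₀ c hc w hw hwc
    have hl := (hgood.label_mem (t := c) (by simp [hc])).2
    rw [hb, List.length_cons, List.length_map] at hl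
    rw [hb, cuts_cons_map_shiftAt h.perm h1, filter_cuts_le_one h.perm, Finset.mem_insert,
      Finset.mem_singleton] at hw
    omega
  · rw [hb, card_cuts_cons_map_shiftAt h.perm h1, filter_cuts_le_one h.perm,
      Finset.card_singleton]

/-- The good queues that reduce to a given queue in one step. -/
theorem IsBuildable.cases {Q Q' : List UBTree} (h : IsBuildable Q) (hQ : Q ≠ [])
    (h' : IsGoodQueue Q') (hpop : popQueue Q' = Q) :
    (∃ v ∈ cuts (queueBfs Q), Q' = _root_.leafExt Q v) ∨
      (∃ Q₀ c, Q = Q₀ ++ [c] ∧ Q' = unExt Q₀ c) ∨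
      ∃ Q₀ l r, Q = Q₀ ++ [l, r] ∧ Q' = binExt Q₀ l r := by
  rcases Q' with _ | ⟨t, ts⟩
  · exact absurd hpop.symm hQ
  have hv := h'.label_mem_cuts
  have hc := h'.append_children
  have hinc := (increasing_iff t).1 (h'.increasing t List.mem_cons_self)
  rw [hpop] at hv hc
  obtain ⟨Q₀, c, rfl⟩ := Q.eq_nil_or_concat'.resolve_left hQ
  have hone (hlt : t.label < (c.mapLabels (shiftAt t.label)).label) : t.label = 1 := by
    refine h.eq_one Q₀ c rfl _ hv ?_
    rw [label_mapLabels, shiftAt] at hlt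
    split_ifs at hlt <;> omega
  rcases t with a | ⟨a, c'⟩ | ⟨a, l, r⟩
  · refine Or.inl ⟨a, hv, ?_⟩
    simp only [children, List.append_nil, label] at hc
    rw [_root_.leafExt, hc]
  · simp only [children, List.map_append, List.map_singleton, List.append_singleton_inj,
      label] at hc hone hinc
    obtain ⟨rfl, rfl⟩ := hc
    obtain rfl := hone (hinc _ (by simp)).1
    exact Or.inr (Or.inl ⟨Q₀, c, rfl, rfl⟩)
  · have hsplit : ts ++ [l, r] = (ts ++ [l]) ++ [r] := by simp
    simp only [children, hsplit, List.map_append, List.map_singleton,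
      List.append_singleton_inj, label] at hc hone hinc
    obtain ⟨hc, rfl⟩ := hc
    obtain rfl := hone (hinc _ (by simp)).1
    rcases Q₀.eq_nil_or_concat' with rfl | ⟨Q₁, l', rfl⟩
    · simp at hc
    · rw [List.map_append, List.map_singleton, List.append_singleton_inj] at hc
      obtain ⟨rfl, rfl⟩ := hc
      exact Or.inr (Or.inr ⟨Q₁, l', c, by simp, rfl⟩)

theorem IsGoodQueue.iterate_popQueue {Q : List UBTree} (h : IsGoodQueue Q) (j : ℕ) :
    IsGoodQueue (_root_.popQueue^[j] Q) := by
  induction j with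
  | zero => exact h
  | succ j ih =>
    rw [Function.iterate_succ_apply']
    exact ih.popQueue

theorem treeCompletions_subset {j : ℕ} {Q Q' : List UBTree} {M : ℕ} (h : popQueue Q' = Q) :
    treeCompletions j Q' M ⊆ treeCompletions (j + 1) Q M := by
  rintro S ⟨h1, h2, h3, h4⟩
  exact ⟨h1, h2, h3, by rw [Function.iterate_succ_apply', h4, h]⟩

theorem disjoint_treeCompletions {j : ℕ} {Q Q' : List UBTree} {M : ℕ} (h : Q ≠ Q') :
    Disjoint (treeCompletions j Q M) (treeCompletions j Q' M) := by
  rw [Set.disjoint_left]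
  rintro S ⟨-, -, -, h4⟩ ⟨-, -, -, h4'⟩
  exact h (h4.symm.trans h4')

theorem Set.encard_biUnion_finset {ι α : Type*} (s : Finset ι) (f : ι → Set α)
    (h : ∀ i ∈ s, ∀ j ∈ s, i ≠ j → Disjoint (f i) (f j)) :
    (⋃ i ∈ s, f i).encard = ∑ i ∈ s, (f i).encard := by
  classical
  induction s using Finset.induction_on with
  | empty => simp
  | insert a s ha ih =>
    rw [Finset.set_biUnion_insert, Set.encard_union_eq, Finset.sum_insert ha,
      ih fun i hi j hj => h i (Finset.mem_insert_of_mem hi) j (Finset.mem_insert_of_mem hj)]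
    rw [Set.disjoint_iUnion₂_right]
    intro i hi
    exact h a (Finset.mem_insert_self _ _) i (Finset.mem_insert_of_mem hi)
      fun hai => ha (hai ▸ hi)

theorem encard_biUnion_leafExt (j : ℕ) (Q : List UBTree) (M : ℕ) :
    (⋃ v ∈ cuts (queueBfs Q), treeCompletions j (leafExt Q v) M).encard =
      ∑ v ∈ cuts (queueBfs Q), (treeCompletions j (leafExt Q v) M).encard := by
  refine Set.encard_biUnion_finset _ _ fun v _ w _ hvw => disjoint_treeCompletions fun h => ?_
  simp only [leafExt, List.cons.injEq, UBTree.lf.injEq] at h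
  exact hvw h.1

theorem treeCompletions_succ_singleton (j : ℕ) {c : UBTree} {M : ℕ} (h : IsBuildable [c]) :
    (treeCompletions (j + 1) [c] M).encard =
      ∑ v ∈ cuts (queueBfs [c]), (treeCompletions j (leafExt [c] v) M).encard +
        (treeCompletions j (unExt [] c) M).encard := by
  rw [← encard_biUnion_leafExt, ← Set.encard_union_eq]
  · congr 1
    refine Set.Subset.antisymm ?_ (Set.union_subset (Set.iUnion₂_subset fun v _ =>
      treeCompletions_subset (popQueue_leafExt _ v)) (treeCompletions_subset (popQueue_unExt _ _)))
    rintro S ⟨h1, h2, h3, h4⟩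
    rw [Function.iterate_succ_apply'] at h4
    rcases h.cases (by simp) (h2.iterate_popQueue j) h4 with
      ⟨v, hv, hS⟩ | ⟨Q₀, d, hQ, hS⟩ | ⟨Q₀, l, r, hQ, hS⟩
    · exact Or.inl (Set.mem_iUnion₂.2 ⟨v, hv, h1, h2, h3, hS⟩)
    · obtain ⟨rfl, rfl⟩ := List.append_singleton_inj.1 ((List.nil_append [c]).trans hQ)
      exact Or.inr ⟨h1, h2, h3, hS⟩
    · have := congrArg List.length hQ
      simp at this
  · rw [Set.disjoint_iUnion₂_left]
    intro v _
    refine disjoint_treeCompletions ?_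
    simp [leafExt, unExt]

theorem treeCompletions_succ_append_pair (j : ℕ) {Q : List UBTree} {l r : UBTree} {M : ℕ}
    (h : IsBuildable (Q ++ [l, r])) :
    (treeCompletions (j + 1) (Q ++ [l, r]) M).encard =
      ∑ v ∈ cuts (queueBfs (Q ++ [l, r])), (treeCompletions j (leafExt (Q ++ [l, r]) v) M).encard +
        (treeCompletions j (unExt (Q ++ [l]) r) M).encard +
        (treeCompletions j (binExt Q l r) M).encard := by
  have hsplit : (Q ++ [l]) ++ [r] = Q ++ [l, r] := by simp
  rw [← encard_biUnion_leafExt, ← Set.encard_union_eq, ← Set.encard_union_eq]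
  · congr 1
    refine Set.Subset.antisymm ?_ (Set.union_subset (Set.union_subset
      (Set.iUnion₂_subset fun v _ => treeCompletions_subset (popQueue_leafExt _ v))
      (treeCompletions_subset ((popQueue_unExt _ _).trans hsplit)))
      (treeCompletions_subset (popQueue_binExt _ _ _)))
    rintro S ⟨h1, h2, h3, h4⟩
    rw [Function.iterate_succ_apply'] at h4
    rcases h.cases (by simp) (h2.iterate_popQueue j) h4 with
      ⟨v, hv, hS⟩ | ⟨Q₀, d, hQ, hS⟩ | ⟨Q₀, l', r', hQ, hS⟩
    · exact Or.inl (Or.inl (Set.mem_iUnion₂.2 ⟨v, hv, h1, h2, h3, hS⟩))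
    · obtain ⟨rfl, rfl⟩ := List.append_singleton_inj.1 (hsplit.trans hQ)
      exact Or.inl (Or.inr ⟨h1, h2, h3, hS⟩)
    · obtain ⟨rfl, h5⟩ := List.append_inj' hQ rfl
      simp only [List.cons.injEq, and_true] at h5
      obtain ⟨rfl, rfl⟩ := h5
      exact Or.inr ⟨h1, h2, h3, hS⟩
  · rw [Set.disjoint_union_left, Set.disjoint_iUnion₂_left]
    refine ⟨fun v _ => disjoint_treeCompletions ?_, disjoint_treeCompletions ?_⟩
    · simp [leafExt, binExt]
    · simp [unExt, binExt]
  · rw [Set.disjoint_iUnion₂_left]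
    intro v _
    refine disjoint_treeCompletions ?_
    simp [leafExt, unExt]

theorem queueUnary_leafExt (Q : List UBTree) (v : ℕ) :
    queueUnary (leafExt Q v) = queueUnary Q := by
  rw [← queueUnary_map_mapLabels (shiftAt v) Q]
  simp [queueUnary, leafExt, unaryCount]

theorem queueUnary_unExt (Q : List UBTree) (c : UBTree) :
    queueUnary (unExt Q c) = queueUnary (Q ++ [c]) + 1 := by
  rw [← queueUnary_map_mapLabels (shiftAt 1) (Q ++ [c])]
  simp [queueUnary, unExt, unaryCount]
  ring

theorem queueUnary_binExt (Q : List UBTree) (l r : UBTree) :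
    queueUnary (binExt Q l r) = queueUnary (Q ++ [l, r]) := by
  rw [← queueUnary_map_mapLabels (shiftAt 1) (Q ++ [l, r])]
  simp [queueUnary, binExt, unaryCount]
  ring

open Polynomial in
theorem encard_treeCompletions (j : ℕ) {Q : List UBTree} (h : IsBuildable Q) (hQ : Q ≠ [])
    (M : ℕ) : (treeCompletions j Q M).encard =
      ((X ^ queueUnary Q *
        treeWeight (X : ℕ[X]) j Q.length (cuts (queueBfs Q)).card).coeff M : ℕ) := by
  induction j generalizing Q with
  | zero =>
    by_cases hc : Q.length = 1 ∧ queueUnary Q = M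
    · have : treeCompletions 0 Q M = {Q} := by
        ext Q'
        simp only [treeCompletions, Set.mem_ofPred_eq, Function.iterate_zero, id_eq,
          Set.mem_singleton_iff]
        constructor
        · exact fun h => h.2.2.2
        · rintro rfl
          exact ⟨hc.1, h.toIsGoodQueue, hc.2, rfl⟩
      rw [this, hc.1, hc.2]
      simp [treeWeight]
    · have : treeCompletions 0 Q M = ∅ := by
        rw [Set.eq_empty_iff_forall_notMem]
        rintro Q' ⟨h1, h2, h3, rfl⟩
        exact hc ⟨h1, h3⟩
      rw [this]
      by_cases h1 : Q.length = 1
      · have h2 : M ≠ queueUnary Q := fun h2 => hc ⟨h1, h2.symm⟩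
        simp [treeWeight, h1, coeff_X_pow, h2]
      · simp [treeWeight, h1]
  | succ j ih =>
    have hleaf : ∑ v ∈ cuts (queueBfs Q), (treeCompletions j (leafExt Q v) M).encard =
        ((X ^ queueUnary Q * ∑ i ∈ Finset.range (cuts (queueBfs Q)).card,
          treeWeight (X : ℕ[X]) j (Q.length + 1) (i + 2)).coeff M : ℕ) := by
      rw [← sum_card_filter_le (cuts (queueBfs Q))
        fun i => treeWeight (X : ℕ[X]) j (Q.length + 1) (i + 1), Finset.mul_sum,
        finsetSum_coeff, Nat.cast_sum]
      refine Finset.sum_congr rfl fun v hv => ?_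
      rw [ih (h.leafExt hQ hv) (by simp [leafExt]), queueUnary_leafExt, card_cuts_leafExt h hv]
      simp [leafExt]
    obtain ⟨Q₀, r, rfl⟩ := Q.eq_nil_or_concat'.resolve_left hQ
    obtain ⟨hu1, hu2⟩ := h.toIsGoodQueue.cons_one (ts := Q₀.map (mapLabels (shiftAt 1)))
      (t := .un 1 (r.mapLabels (shiftAt 1))) rfl (by simp [children])
    have hun := ih hu1 (by simp)
    rw [hu2, ← unExt, queueUnary_unExt] at hun
    rcases Q₀.eq_nil_or_concat' with rfl | ⟨Q₁, l, rfl⟩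
    · have := treeCompletions_succ_singleton j (M := M) h
      simp only [List.nil_append] at *
      rw [this, hleaf, hun]
      simp [treeWeight, unExt, mul_add, pow_succ, mul_assoc]
    · have hsplit : (Q₁ ++ [l]) ++ [r] = Q₁ ++ [l, r] := by simp
      obtain ⟨hb1, hb2⟩ := h.toIsGoodQueue.cons_one (ts := Q₁.map (mapLabels (shiftAt 1)))
        (t := .bin 1 (l.mapLabels (shiftAt 1)) (r.mapLabels (shiftAt 1))) rfl (by simp [children])
      have hbin := ih hb1 (by simp)
      rw [hb2, ← binExt, queueUnary_binExt] at hbin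
      rw [hsplit] at h hleaf hun ⊢
      have := treeCompletions_succ_append_pair j (M := M) h
      rw [this, hleaf, hun, hbin]
      simp [treeWeight, unExt, binExt, mul_add, pow_succ, mul_assoc]

theorem IsGoodQueue.eq_of_queueSize {Q : List UBTree} (h : IsGoodQueue Q)
    (hs : queueSize Q = 1) : Q = [.lf 1] := by
  have hp := h.perm
  rw [length_queueBfs, hs] at hp
  rcases Q with _ | ⟨t, ts⟩
  · simp [queueSize] at hs
  · rw [queueSize_cons] at hs
    have h0 : ts ++ t.children = [] := by
      rcases hc : ts ++ t.children with _ | ⟨c, cs⟩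
      · rfl
      · rw [hc, queueSize_cons] at hs
        omega
    rw [queueBfs_cons, h0] at hp
    have hl : t.label = 1 := by simpa [queueBfs, queueSize, bfsAux] using hp
    rw [List.append_eq_nil_iff] at h0
    obtain ⟨rfl, h0⟩ := h0
    rcases t with a | ⟨a, c⟩ | ⟨a, l, r⟩
    · rw [show a = 1 from hl]
    · simp [children] at h0
    · simp [children] at h0

theorem queueSize_iterate_popQueue (Q : List UBTree) (j : ℕ) :
    queueSize (popQueue^[j] Q) = queueSize Q - j := by
  induction j with
  | zero => rfl
  | succ j ih =>
    rw [Function.iterate_succ_apply', queueSize_popQueue, ih]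
    omega

theorem queueBfs_leaf : queueBfs [.lf 1] = [1] := rfl

theorem cuts_one : cuts [1] = {1, 2} := by
  ext w
  simp [mem_cuts]
  omega

theorem isBuildable_leaf : IsBuildable [.lf 1] where
  increasing := by simp [increasing]
  perm := by simp [queueBfs_leaf]
  avoids := by
    intro i1 i2 i3 h1 h2 h3
    simp [queueBfs_leaf] at h3
    omega
  eq_one := by
    intro Q₀ c hc w hw hwc
    obtain ⟨rfl, rfl⟩ := List.append_singleton_inj.1 ((List.nil_append _).trans hc)
    rw [queueBfs_leaf, cuts_one] at hw
    simp [label] at hw hwc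
    omega

theorem image_singleton_isGoodUB (n m : ℕ) :
    (fun t => [t]) '' {t : UBTree | t.size = n + 1 ∧ IsGoodUB t ∧ t.unaryCount = m} =
      treeCompletions n [.lf 1] m := by
  ext Q
  constructor
  · rintro ⟨t, ⟨h1, h2, h3⟩, rfl⟩
    rw [isGoodUB_iff] at h2
    refine ⟨rfl, h2, by simpa [queueUnary] using h3,
      (h2.iterate_popQueue n).eq_of_queueSize ?_⟩
    rw [queueSize_iterate_popQueue]
    simp [queueSize, h1]
  · rintro ⟨h1, h2, h3, h4⟩
    obtain ⟨t, rfl⟩ := List.length_eq_one_iff.1 h1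
    refine ⟨t, ⟨?_, (isGoodUB_iff t).2 h2, by simpa [queueUnary] using h3⟩, rfl⟩
    have := queueSize_iterate_popQueue [t] n
    rw [h4] at this
    simp [queueSize, size] at this
    omega

open Polynomial in
theorem card_isGoodUB (n m : ℕ) :
    Nat.card {t : UBTree // t.size = n + 1 ∧ IsGoodUB t ∧ t.unaryCount = m} =
      (treeWeight (X : ℕ[X]) n 1 2).coeff m := by
  have h := encard_treeCompletions n isBuildable_leaf (by simp) m
  rw [← image_singleton_isGoodUB, (List.singleton_injective).encard_image, queueBfs_leaf,
    cuts_one] at h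
  change Nat.card ↥{t : UBTree | t.size = n + 1 ∧ IsGoodUB t ∧ t.unaryCount = m} = _
  rw [Nat.card_coe_set_eq, Set.ncard, h]
  simp [queueUnary, unaryCount]

open Polynomial in
theorem walkWeight_X_eq_treeWeight (n : ℕ) :
    walkWeight (X : ℕ[X]) (n + 1) [false] = treeWeight X n 1 2 := by
  refine Polynomial.map_injective (Nat.castRingHom ℤ) Nat.cast_injective ?_
  rw [← coe_mapRingHom, map_walkWeight, map_treeWeight, walkWeight_eq_treeWeight]

/-- G-walks with exactly `m` staggered `±2`-steps are equinumerous with increasing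
unary-binary trees with associated permutation avoiding 213 and exactly `m` unary nodes. -/
theorem stmt7 (n m : ℕ) (hn : 1 ≤ n) :
    Nat.card {s : List ℤ // IsGWalk s ∧ s.length = n ∧ staggeredCount s = m} =
    Nat.card {t : UBTree // t.size = n ∧ IsGoodUB t ∧ t.unaryCount = m} := by
  obtain ⟨k, rfl⟩ : ∃ k, n = k + 1 := ⟨n - 1, by omega⟩
  rw [card_isGWalk, card_isGoodUB, walkWeight_X_eq_treeWeight]
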